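/- Let 2 < p < ∞, let M, N, n be positive integers, and let ν be a probability measure on M̄ = {1,…,M} with ν{i} ≤ 4/N for every i. Define δ(y, z) = (Σ_{i=1}^M [ν{i}(|y_i|^p − |z_i|^p)]^2)^{1/2} for vectors y, z ∈ ℝ^M. Then for all y, z with ‖y‖_{L_p(ν)} ≤ 1, ‖z‖_{L_p(ν)} ≤ 1, ‖y‖_∞ ≤ (2n)^{1/2}, and ‖z‖_∞ ≤ (2n)^{1/2}, one has δ(y, z)^2 ≤ 4 p^2 2^{p/2} n^{(p−2)/2} N^{−1} ‖y − z‖_∞^2. -/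

import Mathlib

open scoped BigOperators

/-- The tangent-line bound for the convex function `x ↦ x ^ p` at its larger argument. -/
lemma rpow_sub_rpow_le_mul_sub {p a b : ℝ} (hp : 1 ≤ p) (hb : 0 ≤ b) (hba : b ≤ a) :
    a ^ p - b ^ p ≤ p * a ^ (p - 1) * (a - b) := by
  rcases (hb.trans hba).eq_or_lt with rfl | ha
  · obtain rfl : b = 0 := le_antisymm hba hb
    simp
  have hbern := one_add_mul_self_le_rpow_one_add (s := b / a - 1)
    (by linarith [div_nonneg hb ha.le]) hp
  rw [add_sub_cancel, Real.div_rpow hb ha.le, le_div_iff₀ (Real.rpow_pos_of_pos ha p)] at hbern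
  have hmul : a ^ p = a ^ (p - 1) * a := by
    rw [← Real.rpow_add_one ha.ne', sub_add_cancel]
  have hexpand : (1 + p * (b / a - 1)) * a ^ p = a ^ p - p * a ^ (p - 1) * (a - b) := by
    have hdiv : b / a * a = b := div_mul_cancel₀ b ha.ne'
    rw [hmul]
    linear_combination p * a ^ (p - 1) * hdiv
  linarith

lemma sq_rpow_sub_rpow_le_of_le {p a b R : ℝ} (hp : 2 < p) (hb : 0 ≤ b) (hba : b ≤ a)
    (haR : a ≤ R) :
    (a ^ p - b ^ p) ^ 2 ≤ p ^ 2 * R ^ (p - 2) * (a ^ p + b ^ p) * (a - b) ^ 2 := by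
  have ha : 0 ≤ a := hb.trans hba
  have hsub : 0 ≤ a ^ p - b ^ p :=
    sub_nonneg.2 (Real.rpow_le_rpow hb hba (by linarith))
  have hpow : (a ^ (p - 1)) ^ 2 = a ^ (p - 2) * a ^ p := by
    rw [sq, ← Real.rpow_add_of_nonneg ha (by linarith) (by linarith),
      ← Real.rpow_add_of_nonneg ha (by linarith) (by linarith)]
    ring_nf
  have hR : a ^ (p - 2) ≤ R ^ (p - 2) := Real.rpow_le_rpow ha haR (by linarith)
  have hR0 : 0 ≤ R ^ (p - 2) := Real.rpow_nonneg (ha.trans haR) _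
  have ha0 : 0 ≤ a ^ p := Real.rpow_nonneg ha _
  have hb0 : 0 ≤ b ^ p := Real.rpow_nonneg hb _
  calc (a ^ p - b ^ p) ^ 2 ≤ (p * a ^ (p - 1) * (a - b)) ^ 2 :=
        pow_le_pow_left₀ hsub (rpow_sub_rpow_le_mul_sub (by linarith) hb hba) 2
    _ = p ^ 2 * (a ^ (p - 2) * a ^ p) * (a - b) ^ 2 := by rw [← hpow]; ring
    _ ≤ p ^ 2 * (R ^ (p - 2) * (a ^ p + b ^ p)) * (a - b) ^ 2 := by
        gcongr
        linarith
    _ = p ^ 2 * R ^ (p - 2) * (a ^ p + b ^ p) * (a - b) ^ 2 := by ring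

lemma sq_rpow_sub_rpow_le {p a b R : ℝ} (hp : 2 < p) (ha : 0 ≤ a) (hb : 0 ≤ b)
    (haR : a ≤ R) (hbR : b ≤ R) :
    (a ^ p - b ^ p) ^ 2 ≤ p ^ 2 * R ^ (p - 2) * (a ^ p + b ^ p) * (a - b) ^ 2 := by
  rcases le_total b a with h | h
  · exact sq_rpow_sub_rpow_le_of_le hp hb h haR
  · rw [sub_sq_comm (a ^ p), sub_sq_comm a, add_comm (a ^ p)]
    exact sq_rpow_sub_rpow_le_of_le hp ha h hbR

/-- Let `2 < p < ∞` and let `ν` be a probability measure on `{1,…,M}` with all atoms of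
mass at most `4/N`. For the Gaussian-process distance
`δ(y,z) = (∑_i [ν{i}(|y_i|^p − |z_i|^p)]^2)^{1/2}`, any `y, z` in the unit ball of
`L_p(ν)` with `‖y‖_∞ ≤ (2n)^{1/2}` and `‖z‖_∞ ≤ (2n)^{1/2}` satisfy
`δ(y,z)^2 ≤ 4 p^2 2^{p/2} n^{(p−2)/2} N^{-1} ‖y − z‖_∞^2`. -/
theorem delta_dist_bound_two_lt_p
    (p : ℝ) (hp : 2 < p) (M N n : ℕ) (hM : 0 < M) (hN : 0 < N) (hn : 0 < n)
    (ν : Fin M → ℝ) (hν0 : ∀ i, 0 ≤ ν i) (hν1 : ∑ i, ν i = 1)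
    (hatom : ∀ i, ν i ≤ 4 / N)
    (y z : Fin M → ℝ)
    (hy : ∑ i, ν i * |y i| ^ p ≤ 1) (hz : ∑ i, ν i * |z i| ^ p ≤ 1)
    (hyinf : ∀ i, |y i| ≤ Real.sqrt (2 * n)) (hzinf : ∀ i, |z i| ≤ Real.sqrt (2 * n)) :
    ∑ i, (ν i * (|y i| ^ p - |z i| ^ p)) ^ 2 ≤
      4 * p ^ 2 * (2 : ℝ) ^ (p / 2) * (n : ℝ) ^ ((p - 2) / 2) * (N : ℝ)⁻¹ *
        (sSup (Set.range fun i => |y i - z i|)) ^ 2 := by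
  set D := sSup (Set.range fun i => |y i - z i|)
  have hD : ∀ i, |y i - z i| ≤ D := fun i =>
    le_csSup (Set.finite_range _).bddAbove (Set.mem_range_self i)
  set C := p ^ 2 * Real.sqrt (2 * n) ^ (p - 2)
  have hC : 0 ≤ C := by positivity
  have hterm : ∀ i, (ν i * (|y i| ^ p - |z i| ^ p)) ^ 2 ≤
      4 / N * C * D ^ 2 * (ν i * |y i| ^ p + ν i * |z i| ^ p) := by
    intro i
    have hν : 0 ≤ ν i := hν0 i
    have hdiff : (|y i| - |z i|) ^ 2 ≤ D ^ 2 :=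
      sq_le_sq.2 (((abs_abs_sub_abs_le (y i) (z i)).trans (hD i)).trans (le_abs_self D))
    calc (ν i * (|y i| ^ p - |z i| ^ p)) ^ 2
        = ν i * ν i * (|y i| ^ p - |z i| ^ p) ^ 2 := by ring
      _ ≤ 4 / N * ν i * (C * (|y i| ^ p + |z i| ^ p) * D ^ 2) := by
          gcongr
          · exact hatom i
          · exact (sq_rpow_sub_rpow_le hp (abs_nonneg _) (abs_nonneg _) (hyinf i)
              (hzinf i)).trans (by gcongr)
      _ = 4 / N * C * D ^ 2 * (ν i * |y i| ^ p + ν i * |z i| ^ p) := by ring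
  have hconst : C * 2 = p ^ 2 * (2 : ℝ) ^ (p / 2) * (n : ℝ) ^ ((p - 2) / 2) := by
    have htwo : (2 : ℝ) ^ (p / 2) = 2 ^ ((p - 2) / 2) * 2 := by
      rw [← Real.rpow_add_one two_ne_zero]
      ring_nf
    simp only [C]
    rw [Real.sqrt_eq_rpow, ← Real.rpow_mul (by positivity), one_div_mul_eq_div,
      Real.mul_rpow zero_le_two n.cast_nonneg, htwo]
    ring
  calc ∑ i, (ν i * (|y i| ^ p - |z i| ^ p)) ^ 2
      ≤ ∑ i, 4 / N * C * D ^ 2 * (ν i * |y i| ^ p + ν i * |z i| ^ p) :=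
        Finset.sum_le_sum fun i _ => hterm i
    _ = 4 / N * C * D ^ 2 * (∑ i, ν i * |y i| ^ p + ∑ i, ν i * |z i| ^ p) := by
        rw [← Finset.mul_sum, Finset.sum_add_distrib]
    _ ≤ 4 / N * C * D ^ 2 * 2 := by
        gcongr
        linarith
    _ = 4 * p ^ 2 * (2 : ℝ) ^ (p / 2) * (n : ℝ) ^ ((p - 2) / 2) * (N : ℝ)⁻¹ * D ^ 2 := by
        linear_combination 4 * (N : ℝ)⁻¹ * D ^ 2 * hconst
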